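/- Let M be a complex manifold, S a closed subset, U_0 = M ∖ S, U_1 a neighborhood of S, and 𝒰 = {U_0, U_1}. There is a commutative diagram with exact rows: the first row is H^{p-1,q-1}_A(𝒰, U_0) → H^{p-1,q-1}_A(𝒰) → H^{p-1,q-1}_A(U_0) → H^{p,q}_{BC}(𝒰, U_0) → H^{p,q}_{BC}(𝒰) → H^{p,q}_{BC}(U_0), the second row is H^{p,q-1}_{∂̄ϑ}(𝒰, U_0) → H^{p,q-1}_{∂̄ϑ}(𝒰) → H^{p,q-1}_{∂̄}(U_0) → H^{p,q}_{∂̄ϑ}(𝒰, U_0) → H^{p,q}_{∂̄ϑ}(𝒰) → H^{p,q}_{∂̄}(U_0), the vertical maps from the Aeppli groups are the homomorphisms ∂ induced by (ξ_0, ξ_1, ξ_{01}^{(1)}, ξ_{01}^{(2)}) ↦ (∂ξ_0, ∂ξ_1, −∂ξ_{01}^{(1)}) (and its relative and global-section versions), and the vertical maps from the Bott-Chern groups are induced by (σ_0, σ_1, σ_{01}) ↦ (σ_0, σ_1, ∂σ_{01}) (and its relative and global-section versions). -/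

import Mathlib

/-!
Statement 10 (Theorem 3.15 of the paper).  Let `M` be a complex manifold, `S` a closed
subset, `U₀ = M ∖ S`, `U₁` a neighborhood of `S`, `𝒰 = {U₀, U₁}`.  There is a commutative
diagram with exact rows
`H^{p-1,q-1}_A(𝒰,U₀) → H^{p-1,q-1}_A(𝒰) → H^{p-1,q-1}_A(U₀) → H^{p,q}_{BC}(𝒰,U₀) →
H^{p,q}_{BC}(𝒰) → H^{p,q}_{BC}(U₀)`  (part of the Bott–Chern/Aeppli long exact sequence)
over
`H^{p,q-1}_{∂̄ϑ}(𝒰,U₀) → H^{p,q-1}_{∂̄ϑ}(𝒰) → H^{p,q-1}_{∂̄}(U₀) → H^{p,q}_{∂̄ϑ}(𝒰,U₀) →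
H^{p,q}_{∂̄ϑ}(𝒰) → H^{p,q}_{∂̄}(U₀)`  (the relative Dolbeault long exact sequence),
where the vertical maps from the Aeppli groups are the `∂`-homomorphisms induced by
`(ξ₀, ξ₁, ξ₀₁⁽¹⁾, ξ₀₁⁽²⁾) ↦ (∂ξ₀, ∂ξ₁, -∂ξ₀₁⁽¹⁾)` (and its relative and open-set
versions), and the vertical maps from the Bott–Chern groups are induced by
`(σ₀, σ₁, σ₀₁) ↦ (σ₀, σ₁, ∂σ₀₁)` (and its relative and open-set versions).

The sheaves of forms are modelled abstractly by `DoubleFormSheaf`; all maps are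
characterized on classes of cocycles by the displayed formulas.
-/

open TopologicalSpace

universe u

section LinearHelpers

variable {A B C S : Type u} [AddCommGroup A] [Module ℂ A] [AddCommGroup B] [Module ℂ B]
  [AddCommGroup C] [Module ℂ C] [AddCommGroup S] [Module ℂ S]

/-- a linear map into a triple product -/
def lmTri (f : S →ₗ[ℂ] A) (g : S →ₗ[ℂ] B) (h : S →ₗ[ℂ] C) : S →ₗ[ℂ] A × B × C :=
  LinearMap.prod f (LinearMap.prod g h)

/-- first projection of a triple product -/
def pA : A × B × C →ₗ[ℂ] A := LinearMap.fst ℂ A (B × C)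

/-- second projection of a triple product -/
def pB : A × B × C →ₗ[ℂ] B := (LinearMap.fst ℂ B C).comp (LinearMap.snd ℂ A (B × C))

/-- third projection of a triple product -/
def pC : A × B × C →ₗ[ℂ] C := (LinearMap.snd ℂ B C).comp (LinearMap.snd ℂ A (B × C))

/-- first projection of a pair -/
def qA : A × B →ₗ[ℂ] A := LinearMap.fst ℂ A B

/-- second projection of a pair -/
def qB : A × B →ₗ[ℂ] B := LinearMap.snd ℂ A B

end LinearHelpers

/-- The cohomology of a pair of composable linear maps `f : A → B`, `g : B → C` with
`g ∘ f = 0` (in the situations where this is used):  `Ker g / Im f`. -/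
abbrev cohomOf {A B C : Type u} [AddCommGroup A] [Module ℂ A] [AddCommGroup B] [Module ℂ B]
    [AddCommGroup C] [Module ℂ C] (f : A →ₗ[ℂ] B) (g : B →ₗ[ℂ] C) : Type u :=
  ↥(LinearMap.ker g) ⧸ (Submodule.comap (LinearMap.ker g).subtype (LinearMap.range f))

/-- The cohomology class of a cocycle. -/
def cohomMk {A B C : Type u} [AddCommGroup A] [Module ℂ A] [AddCommGroup B] [Module ℂ B]
    [AddCommGroup C] [Module ℂ C] (f : A →ₗ[ℂ] B) (g : B →ₗ[ℂ] C) (b : B) (hb : g b = 0) :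
    cohomOf f g :=
  Submodule.Quotient.mk ⟨b, LinearMap.mem_ker.mpr hb⟩

/-- The sheaves `E^{p,q}` of `C^∞` differential forms of type `(p,q)` on (the underlying
topological space of) a complex manifold, encoded abstractly: a presheaf of `ℂ`-modules
`E p q U` with the differentials `∂` (`del`) and `∂̄` (`dbar`), satisfying `∂² = ∂̄² = 0`,
`∂∂̄ + ∂̄∂ = 0`, compatibility with restrictions, the sheaf gluing condition for pairs of
open sets, and the softness property coming from `C^∞` partitions of unity (`pou`). -/
structure DoubleFormSheaf (X : Type u) [TopologicalSpace X] : Type (u + 1) where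
  /-- the `ℂ`-module of `(p,q)`-forms on an open set `U` -/
  E : ℤ → ℤ → Opens X → ModuleCat.{u} ℂ
  /-- restriction of forms -/
  res : ∀ (p q : ℤ) ⦃U V : Opens X⦄, U ≤ V → ((E p q V) →ₗ[ℂ] (E p q U))
  res_refl : ∀ (p q : ℤ) (U : Opens X) (x : E p q U), res p q (le_refl U) x = x
  res_res : ∀ (p q : ℤ) ⦃U V W : Opens X⦄ (hUV : U ≤ V) (hVW : V ≤ W) (x : E p q W),
      res p q hUV (res p q hVW x) = res p q (hUV.trans hVW) x
  /-- the differential `∂` -/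
  del : ∀ (p q : ℤ) (U : Opens X), (E p q U) →ₗ[ℂ] (E (p + 1) q U)
  /-- the differential `∂̄` -/
  dbar : ∀ (p q : ℤ) (U : Opens X), (E p q U) →ₗ[ℂ] (E p (q + 1) U)
  del_del : ∀ (p q : ℤ) (U : Opens X) (x : E p q U), del (p + 1) q U (del p q U x) = 0
  dbar_dbar : ∀ (p q : ℤ) (U : Opens X) (x : E p q U), dbar p (q + 1) U (dbar p q U x) = 0
  del_dbar : ∀ (p q : ℤ) (U : Opens X) (x : E p q U),
      del p (q + 1) U (dbar p q U x) + dbar (p + 1) q U (del p q U x) = 0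
  res_del : ∀ (p q : ℤ) ⦃U V : Opens X⦄ (h : U ≤ V) (x : E p q V),
      del p q U (res p q h x) = res (p + 1) q h (del p q V x)
  res_dbar : ∀ (p q : ℤ) ⦃U V : Opens X⦄ (h : U ≤ V) (x : E p q V),
      dbar p q U (res p q h x) = res p (q + 1) h (dbar p q V x)
  /-- sheaf condition: forms agreeing on the overlap glue -/
  glue : ∀ (p q : ℤ) ⦃U V : Opens X⦄ (a : E p q U) (b : E p q V),
      res p q inf_le_left a = res p q inf_le_right b →
      ∃! c : E p q (U ⊔ V), res p q le_sup_left c = a ∧ res p q le_sup_right c = b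
  /-- softness coming from `C^∞` partitions of unity subordinate to a two-set open cover:
  "multiplication by `ρ₁` (resp. `ρ₀`) followed by extension by zero" operators. -/
  pou : ∀ ⦃U V : Opens X⦄, U ⊔ V = ⊤ →
      ∃ (z₀ : ∀ p q : ℤ, ((E p q (U ⊓ V)) →ₗ[ℂ] (E p q U)))
        (z₁ : ∀ p q : ℤ, ((E p q (U ⊓ V)) →ₗ[ℂ] (E p q V))),
        ∀ (p q : ℤ) (x : E p q (U ⊓ V)),
          res p q inf_le_left (z₀ p q x) + res p q inf_le_right (z₁ p q x) = x

namespace DoubleFormSheaf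

variable {X : Type u} [TopologicalSpace X] (F : DoubleFormSheaf X)

/-- identification of the modules of forms in equal bidegrees -/
def cast (U : Opens X) :
    ∀ {p q p' q' : ℤ}, p = p' → q = q' → ((F.E p q U) →ₗ[ℂ] (F.E p' q' U))
  | _, _, _, _, rfl, rfl => LinearMap.id

section Cech

variable (U₀ U₁ : Opens X)

/-- Čech–Bott–Chern cochains `E^{p,q}_{BC}(𝒰) = E^{p,q}(U₀) ⊕ E^{p,q}(U₁) ⊕ E^{p-1,q-1}(U₀₁)` -/
abbrev TBC (p q : ℤ) : Type u :=
  ↥(F.E p q U₀) × ↥(F.E p q U₁) × ↥(F.E (p - 1) (q - 1) (U₀ ⊓ U₁))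

/-- Čech–Aeppli cochains
`E^{p,q}_{A}(𝒰) = E^{p,q}(U₀) ⊕ E^{p,q}(U₁) ⊕ E^{(p-1,q-1)+1}(U₀₁)`,
`E^{(p-1,q-1)+1} = E^{p,q-1} ⊕ E^{p-1,q}` -/
abbrev TA (p q : ℤ) : Type u :=
  ↥(F.E p q U₀) × ↥(F.E p q U₁) ×
    (↥(F.E p (q - 1) (U₀ ⊓ U₁)) × ↥(F.E (p - 1) q (U₀ ⊓ U₁)))

/-- Čech cochains of the third type
`E^{(p,q)+1}(𝒰) = E^{(p,q)+1}(U₀) ⊕ E^{(p,q)+1}(U₁) ⊕ E^{p,q}(U₀₁)`,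
`E^{(p,q)+1} = E^{p+1,q} ⊕ E^{p,q+1}` -/
abbrev TT (p q : ℤ) : Type u :=
  (↥(F.E (p + 1) q U₀) × ↥(F.E p (q + 1) U₀)) ×
    (↥(F.E (p + 1) q U₁) × ↥(F.E p (q + 1) U₁)) × ↥(F.E p q (U₀ ⊓ U₁))

/-- Čech–Dolbeault cochains `E^{p,q}(𝒰) = E^{p,q}(U₀) ⊕ E^{p,q}(U₁) ⊕ E^{p,q-1}(U₀₁)` -/
abbrev TD (p q : ℤ) : Type u :=
  ↥(F.E p q U₀) × ↥(F.E p q U₁) × ↥(F.E p (q - 1) (U₀ ⊓ U₁))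

/-- relative Čech–Bott–Chern cochains `E^{p,q}_{BC}(𝒰, U₀) = E^{p,q}(U₁) ⊕ E^{p-1,q-1}(U₀₁)` -/
abbrev RBC (p q : ℤ) : Type u :=
  ↥(F.E p q U₁) × ↥(F.E (p - 1) (q - 1) (U₀ ⊓ U₁))

/-- relative Čech–Aeppli cochains `E^{p,q}_{A}(𝒰, U₀) = E^{p,q}(U₁) ⊕ E^{(p-1,q-1)+1}(U₀₁)` -/
abbrev RA (p q : ℤ) : Type u :=
  ↥(F.E p q U₁) × (↥(F.E p (q - 1) (U₀ ⊓ U₁)) × ↥(F.E (p - 1) q (U₀ ⊓ U₁)))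

/-- relative Čech cochains of the third type `E^{(p,q)+1}(𝒰, U₀) = E^{(p,q)+1}(U₁) ⊕ E^{p,q}(U₀₁)` -/
abbrev RT (p q : ℤ) : Type u :=
  (↥(F.E (p + 1) q U₁) × ↥(F.E p (q + 1) U₁)) × ↥(F.E p q (U₀ ⊓ U₁))

/-- relative Čech–Dolbeault cochains `E^{p,q}(𝒰, U₀) = E^{p,q}(U₁) ⊕ E^{p,q-1}(U₀₁)` -/
abbrev RD (p q : ℤ) : Type u :=
  ↥(F.E p q U₁) × ↥(F.E p (q - 1) (U₀ ⊓ U₁))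

/-- the Čech differential `E^{p,q}_{BC}(𝒰) → E^{(p,q)+1}(𝒰)`,
`σ ↦ ((∂σ₀, ∂̄σ₀), (∂σ₁, ∂̄σ₁), σ₁ - σ₀ - ∂̄∂σ₀₁)` (i.e. `σ ↦ (dσ₀, dσ₁, σ₁ - σ₀ - ∂̄∂σ₀₁)`) -/
def DtoTT (p q : ℤ) : TBC F U₀ U₁ p q →ₗ[ℂ] TT F U₀ U₁ p q :=
  lmTri
    (LinearMap.prod ((F.del p q U₀).comp pA) ((F.dbar p q U₀).comp pA))
    (LinearMap.prod ((F.del p q U₁).comp pB) ((F.dbar p q U₁).comp pB))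
    (((F.res p q inf_le_right).comp pB - (F.res p q inf_le_left).comp pA) -
      ((F.cast (U₀ ⊓ U₁) (show p - 1 + 1 = p by ring) (show q - 1 + 1 = q by ring)).comp
        ((F.dbar (p - 1 + 1) (q - 1) (U₀ ⊓ U₁)).comp
          ((F.del (p - 1) (q - 1) (U₀ ⊓ U₁)).comp pC))))

/-- the Čech differential `E^{(p,q)+1}(𝒰) → E^{p+1,q+1}_{A?}(𝒰)`; more precisely the
differential `E^{(p,q)+1}(𝒰) → E^{p+1,q+1}(𝒰)`-component of the mixed complex, landing in
the Aeppli-type cochains `E^{p+1,q+1}_{A}(𝒰)`: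
`((α₀,β₀), (α₁,β₁), γ) ↦ (∂̄α₀ + ∂β₀, ∂̄α₁ + ∂β₁, (α₁ - α₀ - ∂γ, β₁ - β₀ - ∂̄γ))` -/
def DtoTA (p q : ℤ) : TT F U₀ U₁ p q →ₗ[ℂ] TA F U₀ U₁ (p + 1) (q + 1) :=
  lmTri
    (((F.dbar (p + 1) q U₀).comp (qA.comp pA)) + ((F.del p (q + 1) U₀).comp (qB.comp pA)))
    (((F.dbar (p + 1) q U₁).comp (qA.comp pB)) + ((F.del p (q + 1) U₁).comp (qB.comp pB)))
    (LinearMap.prod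
      ((F.cast (U₀ ⊓ U₁) rfl (show q = q + 1 - 1 by ring)).comp
        (((F.res (p + 1) q inf_le_right).comp (qA.comp pB) -
            (F.res (p + 1) q inf_le_left).comp (qA.comp pA)) -
          ((F.del p q (U₀ ⊓ U₁)).comp pC)))
      ((F.cast (U₀ ⊓ U₁) (show p = p + 1 - 1 by ring) rfl).comp
        (((F.res p (q + 1) inf_le_right).comp (qB.comp pB) -
            (F.res p (q + 1) inf_le_left).comp (qB.comp pA)) -
          ((F.dbar p q (U₀ ⊓ U₁)).comp pC))))

/-- the Čech differential `E^{p,q}_{A}(𝒰) → E^{p+1,q+1}_{BC}(𝒰)`: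
`(ξ₀, ξ₁, (η₁, η₂)) ↦ (∂̄∂ξ₀, ∂̄∂ξ₁, ξ₁ - ξ₀ - ∂̄η₁ - ∂η₂)` -/
def DtoTBC (p q : ℤ) : TA F U₀ U₁ p q →ₗ[ℂ] TBC F U₀ U₁ (p + 1) (q + 1) :=
  lmTri
    ((F.dbar (p + 1) q U₀).comp ((F.del p q U₀).comp pA))
    ((F.dbar (p + 1) q U₁).comp ((F.del p q U₁).comp pB))
    ((F.cast (U₀ ⊓ U₁) (show p = p + 1 - 1 by ring) (show q = q + 1 - 1 by ring)).comp
      ((((F.res p q inf_le_right).comp pB - (F.res p q inf_le_left).comp pA) -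
          ((F.cast (U₀ ⊓ U₁) rfl (show q - 1 + 1 = q by ring)).comp
            ((F.dbar p (q - 1) (U₀ ⊓ U₁)).comp (qA.comp pC)))) -
        ((F.cast (U₀ ⊓ U₁) (show p - 1 + 1 = p by ring) rfl).comp
          ((F.del (p - 1) q (U₀ ⊓ U₁)).comp (qB.comp pC)))))

/-- the Čech–Dolbeault differential `∂̄ϑ σ = (∂̄σ₀, ∂̄σ₁, σ₁ - σ₀ - ∂̄σ₀₁)` -/
def DD (p q : ℤ) : TD F U₀ U₁ p q →ₗ[ℂ] TD F U₀ U₁ p (q + 1) :=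
  lmTri
    ((F.dbar p q U₀).comp pA)
    ((F.dbar p q U₁).comp pB)
    (((F.cast (U₀ ⊓ U₁) rfl (show q = q + 1 - 1 by ring)).comp
        ((F.res p q inf_le_right).comp pB - (F.res p q inf_le_left).comp pA)) -
      ((F.cast (U₀ ⊓ U₁) rfl (show q - 1 + 1 = q + 1 - 1 by ring)).comp
        ((F.dbar p (q - 1) (U₀ ⊓ U₁)).comp pC)))

/-- the relative Čech differential `E^{p,q}_{BC}(𝒰,U₀) → E^{(p,q)+1}(𝒰,U₀)` -/
def RtoTT (p q : ℤ) : RBC F U₀ U₁ p q →ₗ[ℂ] RT F U₀ U₁ p q :=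
  LinearMap.prod
    (LinearMap.prod ((F.del p q U₁).comp qA) ((F.dbar p q U₁).comp qA))
    (((F.res p q inf_le_right).comp qA) -
      ((F.cast (U₀ ⊓ U₁) (show p - 1 + 1 = p by ring) (show q - 1 + 1 = q by ring)).comp
        ((F.dbar (p - 1 + 1) (q - 1) (U₀ ⊓ U₁)).comp
          ((F.del (p - 1) (q - 1) (U₀ ⊓ U₁)).comp qB))))

/-- the relative Čech differential `E^{(p,q)+1}(𝒰,U₀) → E^{p+1,q+1}_{A}(𝒰,U₀)` -/
def RtoTA (p q : ℤ) : RT F U₀ U₁ p q →ₗ[ℂ] RA F U₀ U₁ (p + 1) (q + 1) :=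
  LinearMap.prod
    (((F.dbar (p + 1) q U₁).comp (qA.comp qA)) + ((F.del p (q + 1) U₁).comp (qB.comp qA)))
    (LinearMap.prod
      ((F.cast (U₀ ⊓ U₁) rfl (show q = q + 1 - 1 by ring)).comp
        (((F.res (p + 1) q inf_le_right).comp (qA.comp qA)) -
          ((F.del p q (U₀ ⊓ U₁)).comp qB)))
      ((F.cast (U₀ ⊓ U₁) (show p = p + 1 - 1 by ring) rfl).comp
        (((F.res p (q + 1) inf_le_right).comp (qB.comp qA)) -
          ((F.dbar p q (U₀ ⊓ U₁)).comp qB))))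

/-- the relative Čech differential `E^{p,q}_{A}(𝒰,U₀) → E^{p+1,q+1}_{BC}(𝒰,U₀)` -/
def RtoTBC (p q : ℤ) : RA F U₀ U₁ p q →ₗ[ℂ] RBC F U₀ U₁ (p + 1) (q + 1) :=
  LinearMap.prod
    ((F.dbar (p + 1) q U₁).comp ((F.del p q U₁).comp qA))
    ((F.cast (U₀ ⊓ U₁) (show p = p + 1 - 1 by ring) (show q = q + 1 - 1 by ring)).comp
      ((((F.res p q inf_le_right).comp qA) -
          ((F.cast (U₀ ⊓ U₁) rfl (show q - 1 + 1 = q by ring)).comp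
            ((F.dbar p (q - 1) (U₀ ⊓ U₁)).comp (qA.comp qB)))) -
        ((F.cast (U₀ ⊓ U₁) (show p - 1 + 1 = p by ring) rfl).comp
          ((F.del (p - 1) q (U₀ ⊓ U₁)).comp (qB.comp qB)))))

/-- the relative Čech–Dolbeault differential -/
def DrD (p q : ℤ) : RD F U₀ U₁ p q →ₗ[ℂ] RD F U₀ U₁ p (q + 1) :=
  LinearMap.prod
    ((F.dbar p q U₁).comp qA)
    (((F.cast (U₀ ⊓ U₁) rfl (show q = q + 1 - 1 by ring)).comp
        ((F.res p q inf_le_right).comp qA)) -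
      ((F.cast (U₀ ⊓ U₁) rfl (show q - 1 + 1 = q + 1 - 1 by ring)).comp
        ((F.dbar p (q - 1) (U₀ ⊓ U₁)).comp qB)))

/-- identification of Čech–Bott–Chern cochains in equal bidegrees -/
def castTBC {p q p' q' : ℤ} (hp : p = p') (hq : q = q') :
    TBC F U₀ U₁ p q →ₗ[ℂ] TBC F U₀ U₁ p' q' :=
  lmTri ((F.cast U₀ hp hq).comp pA) ((F.cast U₁ hp hq).comp pB)
    ((F.cast _ (by rw [hp]) (by rw [hq])).comp pC)

/-- identification of Čech–Aeppli cochains in equal bidegrees -/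
def castTA {p q p' q' : ℤ} (hp : p = p') (hq : q = q') :
    TA F U₀ U₁ p q →ₗ[ℂ] TA F U₀ U₁ p' q' :=
  lmTri ((F.cast U₀ hp hq).comp pA) ((F.cast U₁ hp hq).comp pB)
    (LinearMap.prod ((F.cast _ hp (by rw [hq])).comp (qA.comp pC))
      ((F.cast _ (by rw [hp]) hq).comp (qB.comp pC)))

/-- identification of Čech–Dolbeault cochains in equal bidegrees -/
def castTD {p q p' q' : ℤ} (hp : p = p') (hq : q = q') :
    TD F U₀ U₁ p q →ₗ[ℂ] TD F U₀ U₁ p' q' :=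
  lmTri ((F.cast U₀ hp hq).comp pA) ((F.cast U₁ hp hq).comp pB)
    ((F.cast _ hp (by rw [hq])).comp pC)

/-- identification of relative Čech–Bott–Chern cochains in equal bidegrees -/
def castRBC {p q p' q' : ℤ} (hp : p = p') (hq : q = q') :
    RBC F U₀ U₁ p q →ₗ[ℂ] RBC F U₀ U₁ p' q' :=
  LinearMap.prod ((F.cast U₁ hp hq).comp qA)
    ((F.cast _ (by rw [hp]) (by rw [hq])).comp qB)

/-- identification of relative Čech–Aeppli cochains in equal bidegrees -/
def castRA {p q p' q' : ℤ} (hp : p = p') (hq : q = q') :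
    RA F U₀ U₁ p q →ₗ[ℂ] RA F U₀ U₁ p' q' :=
  LinearMap.prod ((F.cast U₁ hp hq).comp qA)
    (LinearMap.prod ((F.cast _ hp (by rw [hq])).comp (qA.comp qB))
      ((F.cast _ (by rw [hp]) hq).comp (qB.comp qB)))

/-- identification of relative Čech–Dolbeault cochains in equal bidegrees -/
def castRD {p q p' q' : ℤ} (hp : p = p') (hq : q = q') :
    RD F U₀ U₁ p q →ₗ[ℂ] RD F U₀ U₁ p' q' :=
  LinearMap.prod ((F.cast U₁ hp hq).comp qA)
    ((F.cast _ hp (by rw [hq])).comp qB)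

/-- the Čech–Bott–Chern cohomology `H^{p,q}_{BC}(𝒰)` -/
abbrev HBCcech (p q : ℤ) : Type u :=
  cohomOf
    ((castTBC F U₀ U₁ (show p - 1 + 1 = p by ring) (show q - 1 + 1 = q by ring)).comp
      (DtoTBC F U₀ U₁ (p - 1) (q - 1)))
    (DtoTT F U₀ U₁ p q)

/-- the Čech–Aeppli cohomology `H^{p,q}_{A}(𝒰)` -/
abbrev HAcech (p q : ℤ) : Type u :=
  cohomOf
    ((castTA F U₀ U₁ (show p - 1 + 1 = p by ring) (show q - 1 + 1 = q by ring)).comp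
      (DtoTA F U₀ U₁ (p - 1) (q - 1)))
    (DtoTBC F U₀ U₁ p q)

/-- the Čech cohomology of the third type `H^{(p,q)+1}(𝒰)` -/
abbrev HTcech (p q : ℤ) : Type u :=
  cohomOf (DtoTT F U₀ U₁ p q) (DtoTA F U₀ U₁ p q)

/-- the Čech–Dolbeault cohomology `H^{p,q}_{∂̄ϑ}(𝒰)` -/
abbrev HDcech (p q : ℤ) : Type u :=
  cohomOf ((castTD F U₀ U₁ rfl (show q - 1 + 1 = q by ring)).comp (DD F U₀ U₁ p (q - 1)))
    (DD F U₀ U₁ p q)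

/-- the relative Bott–Chern cohomology `H^{p,q}_{BC}(𝒰, U₀)` -/
abbrev HBCrel (p q : ℤ) : Type u :=
  cohomOf
    ((castRBC F U₀ U₁ (show p - 1 + 1 = p by ring) (show q - 1 + 1 = q by ring)).comp
      (RtoTBC F U₀ U₁ (p - 1) (q - 1)))
    (RtoTT F U₀ U₁ p q)

/-- the relative Aeppli cohomology `H^{p,q}_{A}(𝒰, U₀)` -/
abbrev HArel (p q : ℤ) : Type u :=
  cohomOf
    ((castRA F U₀ U₁ (show p - 1 + 1 = p by ring) (show q - 1 + 1 = q by ring)).comp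
      (RtoTA F U₀ U₁ (p - 1) (q - 1)))
    (RtoTBC F U₀ U₁ p q)

/-- the relative cohomology of the third type `H^{(p,q)+1}(𝒰, U₀)` -/
abbrev HTrel (p q : ℤ) : Type u :=
  cohomOf (RtoTT F U₀ U₁ p q) (RtoTA F U₀ U₁ p q)

/-- the relative Dolbeault cohomology `H^{p,q}_{∂̄ϑ}(𝒰, U₀)` -/
abbrev HDrel (p q : ℤ) : Type u :=
  cohomOf ((castRD F U₀ U₁ rfl (show q - 1 + 1 = q by ring)).comp (DrD F U₀ U₁ p (q - 1)))
    (DrD F U₀ U₁ p q)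

end Cech

section OpenSet

variable (W : Opens X)

/-- the differential `∂̄ + ∂ : E^{(p-1,q-1)+1}(W) → E^{p,q}(W)`, `(η₁, η₂) ↦ ∂̄η₁ + ∂η₂` -/
def plusW (p q : ℤ) :
    (↥(F.E p (q - 1) W) × ↥(F.E (p - 1) q W)) →ₗ[ℂ] ↥(F.E p q W) :=
  ((F.cast W rfl (show q - 1 + 1 = q by ring)).comp ((F.dbar p (q - 1) W).comp qA)) +
    ((F.cast W (show p - 1 + 1 = p by ring) rfl).comp ((F.del (p - 1) q W).comp qB))

/-- the differential `∂̄∂ : E^{p,q}(W) → E^{p+1,q+1}(W)` -/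
def ddbarW (p q : ℤ) : ↥(F.E p q W) →ₗ[ℂ] ↥(F.E (p + 1) (q + 1) W) :=
  (F.dbar (p + 1) q W).comp (F.del p q W)

/-- the differential `d : E^{p,q}(W) → E^{(p,q)+1}(W)`, `ω ↦ (∂ω, ∂̄ω)` -/
def dfullW (p q : ℤ) :
    ↥(F.E p q W) →ₗ[ℂ] (↥(F.E (p + 1) q W) × ↥(F.E p (q + 1) W)) :=
  LinearMap.prod (F.del p q W) (F.dbar p q W)

/-- the differential `∂̄ + ∂ : E^{(p,q)+1}(W) → E^{p+1,q+1}(W)`, `(α, β) ↦ ∂̄α + ∂β` -/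
def plusTW (p q : ℤ) :
    (↥(F.E (p + 1) q W) × ↥(F.E p (q + 1) W)) →ₗ[ℂ] ↥(F.E (p + 1) (q + 1) W) :=
  ((F.dbar (p + 1) q W).comp qA) + ((F.del p (q + 1) W).comp qB)

/-- the Bott–Chern cohomology `H^{p,q}_{BC}(W)` of an open set `W` -/
abbrev HBCopen (p q : ℤ) : Type u :=
  cohomOf
    ((F.cast W (show p - 1 + 1 = p by ring) (show q - 1 + 1 = q by ring)).comp
      (ddbarW F W (p - 1) (q - 1)))
    (dfullW F W p q)

/-- the Aeppli cohomology `H^{p,q}_{A}(W)` of an open set `W` -/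
abbrev HAopen (p q : ℤ) : Type u :=
  cohomOf (plusW F W p q) (ddbarW F W p q)

/-- the cohomology of the third type `H^{(p,q)+1}(W)` of an open set `W` -/
abbrev HTopen (p q : ℤ) : Type u :=
  cohomOf (dfullW F W p q) (plusTW F W p q)

/-- the Dolbeault cohomology `H^{p,q}_{∂̄}(W)` of an open set `W` -/
abbrev HDopen (p q : ℤ) : Type u :=
  cohomOf ((F.cast W rfl (show q - 1 + 1 = q by ring)).comp (F.dbar p (q - 1) W))
    (F.dbar p q W)

end OpenSet

section Tilde

variable (U₀ U₁ : Opens X)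

/-- the map `ω ↦ (ω|_{U₀}, ω|_{U₁}, 0)` into Čech–Bott–Chern cochains -/
def tBC (p q : ℤ) : ↥(F.E p q ⊤) →ₗ[ℂ] TBC F U₀ U₁ p q :=
  lmTri (F.res p q le_top) (F.res p q le_top) 0

/-- the map `ω ↦ (ω|_{U₀}, ω|_{U₁}, 0, 0)` into Čech–Aeppli cochains -/
def tA (p q : ℤ) : ↥(F.E p q ⊤) →ₗ[ℂ] TA F U₀ U₁ p q :=
  lmTri (F.res p q le_top) (F.res p q le_top) 0

/-- the map `ω ↦ (ω|_{U₀}, ω|_{U₁}, 0)` into Čech–Dolbeault cochains -/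
def tD (p q : ℤ) : ↥(F.E p q ⊤) →ₗ[ℂ] TD F U₀ U₁ p q :=
  lmTri (F.res p q le_top) (F.res p q le_top) 0

end Tilde

end DoubleFormSheaf

section CohomologyMaps

variable {A B C A' B' C' A'' B'' C'' : Type u}
  [AddCommGroup A] [Module ℂ A] [AddCommGroup B] [Module ℂ B] [AddCommGroup C] [Module ℂ C]
  [AddCommGroup A'] [Module ℂ A'] [AddCommGroup B'] [Module ℂ B'] [AddCommGroup C'] [Module ℂ C']
  [AddCommGroup A''] [Module ℂ A''] [AddCommGroup B''] [Module ℂ B'']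
  [AddCommGroup C''] [Module ℂ C'']

/-- The map on cohomology induced by a map of cochains preserving cocycles and coboundaries. -/
def cohomMap (f : A →ₗ[ℂ] B) (g : B →ₗ[ℂ] C) (f' : A' →ₗ[ℂ] B') (g' : B' →ₗ[ℂ] C')
    (φ : B →ₗ[ℂ] B') (hk : ∀ b, g b = 0 → g' (φ b) = 0) (hr : ∀ a, ∃ a', f' a' = φ (f a)) :
    cohomOf f g →ₗ[ℂ] cohomOf f' g' :=
  Submodule.mapQ _ _ (φ.restrict (p := LinearMap.ker g) (q := LinearMap.ker g') hk) (by
    rintro ⟨b, hb⟩ ⟨a, ha⟩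
    obtain ⟨a', ha'⟩ := hr a
    exact ⟨a', ha'.trans (congrArg φ ha)⟩)

theorem cohomMap_mk (f : A →ₗ[ℂ] B) (g : B →ₗ[ℂ] C) (f' : A' →ₗ[ℂ] B') (g' : B' →ₗ[ℂ] C')
    (φ : B →ₗ[ℂ] B') (hk : ∀ b, g b = 0 → g' (φ b) = 0) (hr : ∀ a, ∃ a', f' a' = φ (f a))
    (b : B) (hb : g b = 0) :
    cohomMap f g f' g' φ hk hr (cohomMk f g b hb) = cohomMk f' g' (φ b) (hk b hb) :=
  rfl

theorem exists_cohomMk {f : A →ₗ[ℂ] B} {g : B →ₗ[ℂ] C} (x : cohomOf f g) :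
    ∃ b hb, x = cohomMk f g b hb := by
  obtain ⟨⟨b, hb⟩, rfl⟩ := Submodule.Quotient.mk_surjective _ x
  exact ⟨b, hb, rfl⟩

theorem cohomMk_eq_iff {f : A →ₗ[ℂ] B} {g : B →ₗ[ℂ] C} {b b' : B} {hb : g b = 0}
    {hb' : g b' = 0} : cohomMk f g b hb = cohomMk f g b' hb' ↔ ∃ a, f a = b - b' :=
  Submodule.Quotient.eq _

theorem cohomMk_eq_zero_iff {f : A →ₗ[ℂ] B} {g : B →ₗ[ℂ] C} {b : B} {hb : g b = 0} :
    cohomMk f g b hb = 0 ↔ ∃ a, f a = b :=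
  Submodule.Quotient.mk_eq_zero _

theorem cohomMap_exact {f : A →ₗ[ℂ] B} {g : B →ₗ[ℂ] C} {f' : A' →ₗ[ℂ] B'} {g' : B' →ₗ[ℂ] C'}
    {f'' : A'' →ₗ[ℂ] B''} {g'' : B'' →ₗ[ℂ] C''} {φ : B →ₗ[ℂ] B'} {ψ : B' →ₗ[ℂ] B''}
    {hk : ∀ b, g b = 0 → g' (φ b) = 0} {hr : ∀ a, ∃ a', f' a' = φ (f a)}
    {hk' : ∀ b, g' b = 0 → g'' (ψ b) = 0} {hr' : ∀ a, ∃ a', f'' a' = ψ (f' a)}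
    (h₀ : ∀ b, g b = 0 → ∃ a, f'' a = ψ (φ b))
    (h₁ : ∀ b', g' b' = 0 → ∀ a, f'' a = ψ b' → ∃ b, g b = 0 ∧ ∃ a', f' a' = φ b - b') :
    Function.Exact (cohomMap f g f' g' φ hk hr) (cohomMap f' g' f'' g'' ψ hk' hr') := by
  intro y
  constructor
  · intro hy
    obtain ⟨b', hb', rfl⟩ := exists_cohomMk y
    rw [cohomMap_mk, cohomMk_eq_zero_iff] at hy
    obtain ⟨a, ha⟩ := hy
    obtain ⟨b, hb, hab⟩ := h₁ b' hb' a ha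
    exact ⟨cohomMk f g b hb, by rw [cohomMap_mk, cohomMk_eq_iff]; exact hab⟩
  · rintro ⟨x, rfl⟩
    obtain ⟨b, hb, rfl⟩ := exists_cohomMk x
    rw [cohomMap_mk, cohomMap_mk, cohomMk_eq_zero_iff]
    exact h₀ b hb

theorem cohomMap_comm {D D' E' : Type u} [AddCommGroup D] [Module ℂ D]
    [AddCommGroup D'] [Module ℂ D'] [AddCommGroup E'] [Module ℂ E']
    {f : A →ₗ[ℂ] B} {g : B →ₗ[ℂ] C} {f₁ : A' →ₗ[ℂ] B'} {g₁ : B' →ₗ[ℂ] C'}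
    {f₂ : D →ₗ[ℂ] D'} {g₂ : D' →ₗ[ℂ] E'} {f' : A'' →ₗ[ℂ] B''} {g' : B'' →ₗ[ℂ] C''}
    {φ₁ : B →ₗ[ℂ] B'} {ψ₁ : B' →ₗ[ℂ] B''} {φ₂ : B →ₗ[ℂ] D'} {ψ₂ : D' →ₗ[ℂ] B''}
    {hk₁ : ∀ b, g b = 0 → g₁ (φ₁ b) = 0} {hr₁ : ∀ a, ∃ a', f₁ a' = φ₁ (f a)}
    {hk₁' : ∀ b, g₁ b = 0 → g' (ψ₁ b) = 0} {hr₁' : ∀ a, ∃ a', f' a' = ψ₁ (f₁ a)}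
    {hk₂ : ∀ b, g b = 0 → g₂ (φ₂ b) = 0} {hr₂ : ∀ a, ∃ a', f₂ a' = φ₂ (f a)}
    {hk₂' : ∀ b, g₂ b = 0 → g' (ψ₂ b) = 0} {hr₂' : ∀ a, ∃ a', f' a' = ψ₂ (f₂ a)}
    (h : ∀ b, ψ₁ (φ₁ b) = ψ₂ (φ₂ b)) (x : cohomOf f g) :
    cohomMap f₁ g₁ f' g' ψ₁ hk₁' hr₁' (cohomMap f g f₁ g₁ φ₁ hk₁ hr₁ x) =
      cohomMap f₂ g₂ f' g' ψ₂ hk₂' hr₂' (cohomMap f g f₂ g₂ φ₂ hk₂ hr₂ x) := by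
  obtain ⟨b, hb, rfl⟩ := exists_cohomMk x
  rw [cohomMap_mk, cohomMap_mk, cohomMap_mk, cohomMap_mk, cohomMk_eq_iff]
  exact ⟨0, by rw [h, sub_self, map_zero]⟩

end CohomologyMaps

namespace DoubleFormSheaf

variable {X : Type u} [TopologicalSpace X] (F : DoubleFormSheaf X)

section Cast

variable {p q p' q' p'' q'' : ℤ} {U V : Opens X}

theorem cast_self (hp : p = p) (hq : q = q) (x : F.E p q U) : F.cast U hp hq x = x := rfl

theorem cast_cast (hp : p = p') (hq : q = q') (hp' : p' = p'') (hq' : q' = q'')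
    (x : F.E p q U) :
    F.cast U hp' hq' (F.cast U hp hq x) = F.cast U (hp.trans hp') (hq.trans hq') x := by
  subst hp hq hp' hq'; rfl

theorem cast_eq_zero_iff (hp : p = p') (hq : q = q') (x : F.E p q U) :
    F.cast U hp hq x = 0 ↔ x = 0 := by
  subst hp hq; rfl

theorem del_cast (hp : p = p') (hq : q = q') (x : F.E p q U) :
    F.del p' q' U (F.cast U hp hq x) = F.cast U (congrArg (· + 1) hp) hq (F.del p q U x) := by
  subst hp hq; rfl

theorem dbar_cast (hp : p = p') (hq : q = q') (x : F.E p q U) :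
    F.dbar p' q' U (F.cast U hp hq x) = F.cast U hp (congrArg (· + 1) hq) (F.dbar p q U x) := by
  subst hp hq; rfl

theorem res_cast (hp : p = p') (hq : q = q') (h : U ≤ V) (x : F.E p q V) :
    F.res p' q' h (F.cast V hp hq x) = F.cast U hp hq (F.res p q h x) := by
  subst hp hq; rfl

theorem del_dbar_eq_neg (x : F.E p q U) :
    F.del p (q + 1) U (F.dbar p q U x) = -F.dbar (p + 1) q U (F.del p q U x) :=
  eq_neg_of_add_eq_zero_left (F.del_dbar p q U x)

end Cast
section Ladder

variable (U₀ U₁ : Opens X) (p q : ℤ)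

attribute [local simp] lmTri pA pB pC qA qB DtoTT DtoTA DtoTBC DD RtoTT RtoTA RtoTBC DrD
  castTBC castTA castTD castRBC castRA castRD plusW ddbarW dfullW
  cast_self cast_cast cast_eq_zero_iff del_cast dbar_cast res_cast del_dbar_eq_neg
  del_del dbar_dbar res_del res_dbar

/-- The map `H_A(𝒰, U₀) → H_A(𝒰)` induced by `ξ ↦ (0, ξ)`. -/
def aeppliRelToCech : HArel F U₀ U₁ p q →ₗ[ℂ] HAcech F U₀ U₁ p q :=
  cohomMap _ _ _ _ (LinearMap.inr ℂ _ _)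
    (by
      rintro ⟨ξ₁, η₁, η₂⟩ h
      simp at h ⊢
      exact h)
    (by
      rintro ⟨⟨α, β⟩, γ⟩
      refine ⟨(0, (α, β), γ), ?_⟩
      simp)

/-- The map `H_A(𝒰) → H_A(U₀)` induced by the first projection. -/
def aeppliCechToOpen : HAcech F U₀ U₁ p q →ₗ[ℂ] HAopen F U₀ p q :=
  cohomMap _ _ _ _ (LinearMap.fst ℂ _ _)
    (by
      rintro ⟨ξ₀, ξ₁, η₁, η₂⟩ h
      simp at h ⊢
      exact h.1)
    (by
      rintro ⟨⟨α₀, β₀⟩, ⟨α₁, β₁⟩, γ⟩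
      refine ⟨(F.cast _ (by ring) (by ring) α₀, F.cast _ (by ring) (by ring) β₀), ?_⟩
      simp)

/-- The connecting map `H_A(U₀) → H_BC(𝒰, U₀)` induced by `θ ↦ (0, -θ)`. -/
def aeppliConnecting : HAopen F U₀ (p - 1) (q - 1) →ₗ[ℂ] HBCrel F U₀ U₁ p q :=
  cohomMap _ _ _ _ (LinearMap.prod 0 (-(F.res (p - 1) (q - 1) inf_le_left)))
    (by
      intro θ h
      simp at h ⊢
      simp [h])
    (by
      rintro ⟨η₁, η₂⟩
      refine ⟨(0, F.res _ _ inf_le_left η₁, F.res _ _ inf_le_left η₂), ?_⟩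
      simp
      abel)

/-- The map `H_BC(𝒰, U₀) → H_BC(𝒰)` induced by `σ ↦ (0, σ)`. -/
def bottChernRelToCech : HBCrel F U₀ U₁ p q →ₗ[ℂ] HBCcech F U₀ U₁ p q :=
  cohomMap _ _ _ _ (LinearMap.inr ℂ _ _)
    (by
      rintro ⟨σ₁, σ₀₁⟩ h
      simp at h ⊢
      exact h)
    (by
      rintro ⟨ξ₁, η₁, η₂⟩
      refine ⟨(0, ξ₁, η₁, η₂), ?_⟩
      simp)

/-- The map `H_BC(𝒰) → H_BC(U₀)` induced by the first projection. -/
def bottChernCechToOpen : HBCcech F U₀ U₁ p q →ₗ[ℂ] HBCopen F U₀ p q :=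
  cohomMap _ _ _ _ (LinearMap.fst ℂ _ _)
    (by
      rintro ⟨σ₀, σ₁, σ₀₁⟩ h
      simp at h ⊢
      exact h.1)
    (by
      rintro ⟨ξ₀, ξ₁, η₁, η₂⟩
      refine ⟨ξ₀, ?_⟩
      simp)

/-- The map `H_∂̄(𝒰, U₀) → H_∂̄(𝒰)` induced by `σ ↦ (0, σ)`. -/
def dolbeaultRelToCech : HDrel F U₀ U₁ p q →ₗ[ℂ] HDcech F U₀ U₁ p q :=
  cohomMap _ _ _ _ (LinearMap.inr ℂ _ _)
    (by
      rintro ⟨σ₁, σ₀₁⟩ h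
      simp at h ⊢
      exact h)
    (by
      rintro ⟨τ₁, τ₀₁⟩
      refine ⟨(0, τ₁, τ₀₁), ?_⟩
      simp)

/-- The map `H_∂̄(𝒰) → H_∂̄(U₀)` induced by the first projection. -/
def dolbeaultCechToOpen : HDcech F U₀ U₁ p q →ₗ[ℂ] HDopen F U₀ p q :=
  cohomMap _ _ _ _ (LinearMap.fst ℂ _ _)
    (by
      rintro ⟨σ₀, σ₁, σ₀₁⟩ h
      simp at h ⊢
      exact h.1)
    (by
      rintro ⟨τ₀, τ₁, τ₀₁⟩
      refine ⟨τ₀, ?_⟩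
      simp)

/-- The connecting map `H_∂̄(U₀) → H_∂̄(𝒰, U₀)` induced by `θ ↦ (0, -θ)`. -/
def dolbeaultConnecting : HDopen F U₀ p (q - 1) →ₗ[ℂ] HDrel F U₀ U₁ p q :=
  cohomMap _ _ _ _ (LinearMap.prod 0 (-(F.res p (q - 1) inf_le_left)))
    (by
      intro θ h
      simp [h])
    (by
      intro τ
      refine ⟨(0, F.res _ _ inf_le_left τ), ?_⟩
      simp)

/-- The map `∂ : H_A(𝒰, U₀) → H_∂̄(𝒰, U₀)`. -/
def delRel : HArel F U₀ U₁ (p - 1) (q - 1) →ₗ[ℂ] HDrel F U₀ U₁ p (q - 1) :=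
  cohomMap _ _ _ _
    (LinearMap.prod
      ((F.cast U₁ (show p - 1 + 1 = p by ring) rfl).comp ((F.del (p - 1) (q - 1) U₁).comp qA))
      (-((F.cast _ (show p - 1 + 1 = p by ring) rfl).comp
        ((F.del (p - 1) (q - 1 - 1) (U₀ ⊓ U₁)).comp (qA.comp qB)))))
    (by
      rintro ⟨ξ₁, η₁, η₂⟩ h
      simp at h ⊢
      refine ⟨h.1, ?_⟩
      have := congrArg (fun x => F.cast _ (p' := p) (q' := q - 1 + 1 - 1) (by ring) (by ring)
        (F.del _ _ _ x)) h.2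
      simpa using this)
    (by
      rintro ⟨⟨α, β⟩, γ⟩
      refine ⟨(-F.cast _ (by ring) (by ring) (F.del _ _ _ α), 0), ?_⟩
      simp)

/-- The map `∂ : H_A(𝒰) → H_∂̄(𝒰)`. -/
def delCech : HAcech F U₀ U₁ (p - 1) (q - 1) →ₗ[ℂ] HDcech F U₀ U₁ p (q - 1) :=
  cohomMap _ _ _ _
    (lmTri
      ((F.cast U₀ (show p - 1 + 1 = p by ring) rfl).comp ((F.del (p - 1) (q - 1) U₀).comp pA))
      ((F.cast U₁ (show p - 1 + 1 = p by ring) rfl).comp ((F.del (p - 1) (q - 1) U₁).comp pB))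
      (-((F.cast _ (show p - 1 + 1 = p by ring) rfl).comp
        ((F.del (p - 1) (q - 1 - 1) (U₀ ⊓ U₁)).comp (qA.comp pC)))))
    (by
      rintro ⟨ξ₀, ξ₁, η₁, η₂⟩ h
      simp at h ⊢
      refine ⟨h.1, h.2.1, ?_⟩
      have := congrArg (fun x => F.cast _ (p' := p) (q' := q - 1 + 1 - 1) (by ring) (by ring)
        (F.del _ _ _ x)) h.2.2
      simpa using this)
    (by
      rintro ⟨⟨α₀, β₀⟩, ⟨α₁, β₁⟩, γ⟩
      refine ⟨(-F.cast _ (by ring) (by ring) (F.del _ _ _ α₀),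
        -F.cast _ (by ring) (by ring) (F.del _ _ _ α₁), 0), ?_⟩
      simp
      abel)

/-- The map `∂ : H_A(U₀) → H_∂̄(U₀)`. -/
def delOpen : HAopen F U₀ (p - 1) (q - 1) →ₗ[ℂ] HDopen F U₀ p (q - 1) :=
  cohomMap _ _ _ _
    ((F.cast U₀ (show p - 1 + 1 = p by ring) rfl).comp (F.del (p - 1) (q - 1) U₀))
    (by
      intro θ h
      simpa using h)
    (by
      rintro ⟨α, β⟩
      refine ⟨-F.cast _ (by ring) (by ring) (F.del _ _ _ α), ?_⟩
      simp)

/-- The map `H_BC(𝒰, U₀) → H_∂̄(𝒰, U₀)` induced by `(σ₁, σ₀₁) ↦ (σ₁, ∂σ₀₁)`. -/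
def bottChernToDolbeaultRel : HBCrel F U₀ U₁ p q →ₗ[ℂ] HDrel F U₀ U₁ p q :=
  cohomMap _ _ _ _
    (LinearMap.prod qA
      ((F.cast _ (show p - 1 + 1 = p by ring) rfl).comp
        ((F.del (p - 1) (q - 1) (U₀ ⊓ U₁)).comp qB)))
    (by
      rintro ⟨σ₁, σ₀₁⟩ h
      simp at h ⊢
      refine ⟨h.1.2, ?_⟩
      have := congrArg (F.cast _ (p' := p) (q' := q + 1 - 1) (by ring) (by ring)) h.2
      simpa using this)
    (by
      rintro ⟨ξ₁, η₁, η₂⟩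
      refine ⟨(F.cast _ (by ring) (by ring) (F.del _ _ _ ξ₁),
        -F.cast _ (by ring) (by ring) (F.del _ _ _ η₁)), ?_⟩
      simp)

/-- The map `H_BC(𝒰) → H_∂̄(𝒰)` induced by `(σ₀, σ₁, σ₀₁) ↦ (σ₀, σ₁, ∂σ₀₁)`. -/
def bottChernToDolbeaultCech : HBCcech F U₀ U₁ p q →ₗ[ℂ] HDcech F U₀ U₁ p q :=
  cohomMap _ _ _ _
    (lmTri pA pB
      ((F.cast _ (show p - 1 + 1 = p by ring) rfl).comp
        ((F.del (p - 1) (q - 1) (U₀ ⊓ U₁)).comp pC)))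
    (by
      rintro ⟨σ₀, σ₁, σ₀₁⟩ h
      simp at h ⊢
      refine ⟨h.1.2, h.2.1.2, ?_⟩
      have := congrArg (F.cast _ (p' := p) (q' := q + 1 - 1) (by ring) (by ring)) h.2.2
      simpa using this)
    (by
      rintro ⟨ξ₀, ξ₁, η₁, η₂⟩
      refine ⟨(F.cast _ (by ring) (by ring) (F.del _ _ _ ξ₀),
        F.cast _ (by ring) (by ring) (F.del _ _ _ ξ₁),
        -F.cast _ (by ring) (by ring) (F.del _ _ _ η₁)), ?_⟩
      simp)

/-- The map `H_BC(U₀) → H_∂̄(U₀)` induced by the identity. -/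
def bottChernToDolbeaultOpen : HBCopen F U₀ p q →ₗ[ℂ] HDopen F U₀ p q :=
  cohomMap _ _ _ _ LinearMap.id
    (by
      intro θ h
      simp at h ⊢
      exact h.2)
    (by
      intro θ
      refine ⟨F.cast _ (by ring) (by ring) (F.del _ _ _ θ), ?_⟩
      simp)

theorem exact_aeppliRelToCech_aeppliCechToOpen :
    Function.Exact (aeppliRelToCech F U₀ U₁ p q) (aeppliCechToOpen F U₀ U₁ p q) := by
  refine cohomMap_exact ?_ ?_
  · rintro ⟨ξ₁, η₁, η₂⟩ h
    exact ⟨0, by simp⟩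
  · rintro ⟨ξ₀, ξ₁, η₁, η₂⟩ h ⟨α, β⟩ hαβ
    simp at h hαβ
    subst hαβ
    refine ⟨(ξ₁, η₁ + F.res _ _ inf_le_left α, η₂ + F.res _ _ inf_le_left β), ?_,
      ((-F.cast _ (by ring) (by ring) α, -F.cast _ (by ring) (by ring) β), 0, 0), ?_⟩
    · simp
      refine ⟨h.2.1, ?_⟩
      rw [← h.2.2]
      simp
      abel
    · simp
      abel

theorem exact_aeppliCechToOpen_aeppliConnecting :
    Function.Exact (aeppliCechToOpen F U₀ U₁ (p - 1) (q - 1)) (aeppliConnecting F U₀ U₁ p q) := by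
  refine cohomMap_exact ?_ ?_
  · rintro ⟨ξ₀, ξ₁, η₁, η₂⟩ h
    refine ⟨(-ξ₁, -η₁, -η₂), ?_⟩
    simp at h ⊢
    refine ⟨h.2.1, ?_⟩
    have := congrArg (F.cast _ (p' := p - 1) (q' := q - 1) (by ring) (by ring)) h.2.2
    simp at this
    rw [← sub_eq_zero, ← neg_eq_zero, ← this]
    abel
  · rintro θ h ⟨ξ₁, η₁, η₂⟩ hξ
    simp at h hξ
    refine ⟨(θ, -ξ₁, -η₁, -η₂), ?_, 0, ?_⟩
    · simp
      refine ⟨h, hξ.1, ?_⟩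
      have := congrArg (F.cast _ (p' := p - 1 + 1 - 1) (q' := q - 1 + 1 - 1) (by ring) (by ring))
        hξ.2
      simp at this
      rw [← sub_eq_zero, ← neg_eq_zero] at this
      rw [← this]
      abel
    · simp

theorem exact_aeppliConnecting_bottChernRelToCech :
    Function.Exact (aeppliConnecting F U₀ U₁ p q) (bottChernRelToCech F U₀ U₁ p q) := by
  refine cohomMap_exact ?_ ?_
  · intro θ h
    refine ⟨(θ, 0), ?_⟩
    simp at h ⊢
    exact h
  · rintro ⟨σ₁, σ₀₁⟩ h ⟨ξ₀, ξ₁, η₁, η₂⟩ hξ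
    simp at h hξ
    refine ⟨ξ₀, ?_, (-ξ₁, -η₁, -η₂), ?_⟩
    · simp
      exact hξ.1
    · simp
      refine ⟨hξ.2.1, ?_⟩
      rw [← hξ.2.2]
      abel

theorem exact_bottChernRelToCech_bottChernCechToOpen :
    Function.Exact (bottChernRelToCech F U₀ U₁ p q) (bottChernCechToOpen F U₀ U₁ p q) := by
  refine cohomMap_exact ?_ ?_
  · rintro ⟨σ₁, σ₀₁⟩ h
    exact ⟨0, by simp⟩
  · rintro ⟨σ₀, σ₁, σ₀₁⟩ h θ hθ
    simp at h hθ
    subst hθ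
    refine ⟨(σ₁, σ₀₁ + F.res _ _ inf_le_left θ), ?_, (-θ, 0, 0), ?_⟩
    · simp
      refine ⟨h.2.1, ?_⟩
      rw [← h.2.2]
      simp
      abel
    · simp

theorem exact_dolbeaultRelToCech_dolbeaultCechToOpen :
    Function.Exact (dolbeaultRelToCech F U₀ U₁ p q) (dolbeaultCechToOpen F U₀ U₁ p q) := by
  refine cohomMap_exact ?_ ?_
  · rintro ⟨σ₁, σ₀₁⟩ h
    exact ⟨0, by simp⟩
  · rintro ⟨σ₀, σ₁, σ₀₁⟩ h θ hθ
    simp at h hθ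
    subst hθ
    refine ⟨(σ₁, σ₀₁ + F.res _ _ inf_le_left θ), ?_, (-θ, 0, 0), ?_⟩
    · simp
      refine ⟨h.2.1, ?_⟩
      rw [← h.2.2]
      simp
      abel
    · simp

theorem exact_dolbeaultCechToOpen_dolbeaultConnecting :
    Function.Exact (dolbeaultCechToOpen F U₀ U₁ p (q - 1)) (dolbeaultConnecting F U₀ U₁ p q) := by
  refine cohomMap_exact ?_ ?_
  · rintro ⟨σ₀, σ₁, σ₀₁⟩ h
    refine ⟨(-σ₁, -σ₀₁), ?_⟩
    simp at h ⊢
    refine ⟨h.2.1, ?_⟩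
    have := congrArg (F.cast _ (p' := p) (q' := q - 1) (by ring) (by ring)) h.2.2
    simp at this
    rw [← sub_eq_zero, ← neg_eq_zero, ← this]
    abel
  · rintro θ h ⟨τ₁, τ₀₁⟩ hτ
    simp at h hτ
    refine ⟨(θ, -τ₁, -τ₀₁), ?_, 0, ?_⟩
    · simp
      refine ⟨h, hτ.1, ?_⟩
      have := congrArg (F.cast _ (p' := p) (q' := q - 1 + 1 - 1) (by ring) (by ring)) hτ.2
      simp at this
      rw [← sub_eq_zero, ← neg_eq_zero] at this
      rw [← this]
      abel
    · simp

theorem exact_dolbeaultConnecting_dolbeaultRelToCech :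
    Function.Exact (dolbeaultConnecting F U₀ U₁ p q) (dolbeaultRelToCech F U₀ U₁ p q) := by
  refine cohomMap_exact ?_ ?_
  · intro θ h
    exact ⟨(θ, 0), by simp [h]⟩
  · rintro ⟨σ₁, σ₀₁⟩ h ⟨τ₀, τ₁, τ₀₁⟩ hτ
    simp at h hτ
    refine ⟨τ₀, hτ.1, (-τ₁, -τ₀₁), ?_⟩
    simp
    refine ⟨hτ.2.1, ?_⟩
    rw [← hτ.2.2]
    abel

theorem delCech_aeppliRelToCech (x : HArel F U₀ U₁ (p - 1) (q - 1)) :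
    delCech F U₀ U₁ p q (aeppliRelToCech F U₀ U₁ (p - 1) (q - 1) x) =
      dolbeaultRelToCech F U₀ U₁ p (q - 1) (delRel F U₀ U₁ p q x) :=
  cohomMap_comm (fun _ => by simp) x

theorem delOpen_aeppliCechToOpen (x : HAcech F U₀ U₁ (p - 1) (q - 1)) :
    delOpen F U₀ p q (aeppliCechToOpen F U₀ U₁ (p - 1) (q - 1) x) =
      dolbeaultCechToOpen F U₀ U₁ p (q - 1) (delCech F U₀ U₁ p q x) :=
  cohomMap_comm (fun _ => by simp) x

theorem bottChernToDolbeaultRel_aeppliConnecting (x : HAopen F U₀ (p - 1) (q - 1)) :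
    bottChernToDolbeaultRel F U₀ U₁ p q (aeppliConnecting F U₀ U₁ p q x) =
      dolbeaultConnecting F U₀ U₁ p q (delOpen F U₀ p q x) :=
  cohomMap_comm (fun _ => by simp) x

theorem bottChernToDolbeaultCech_bottChernRelToCech (x : HBCrel F U₀ U₁ p q) :
    bottChernToDolbeaultCech F U₀ U₁ p q (bottChernRelToCech F U₀ U₁ p q x) =
      dolbeaultRelToCech F U₀ U₁ p q (bottChernToDolbeaultRel F U₀ U₁ p q x) :=
  cohomMap_comm (fun _ => by simp) x

theorem bottChernToDolbeaultOpen_bottChernCechToOpen (x : HBCcech F U₀ U₁ p q) :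
    bottChernToDolbeaultOpen F U₀ p q (bottChernCechToOpen F U₀ U₁ p q x) =
      dolbeaultCechToOpen F U₀ U₁ p q (bottChernToDolbeaultCech F U₀ U₁ p q x) :=
  cohomMap_comm (fun _ => by simp) x

end Ladder

end DoubleFormSheaf

open DoubleFormSheaf

set_option maxHeartbeats 2000000 in
/-- Theorem 3.15 of the paper: the commutative ladder relating the
Bott–Chern/Aeppli long exact sequence to the relative Dolbeault long exact sequence. -/
theorem statement10 {X : Type u} [TopologicalSpace X] (F : DoubleFormSheaf X)
    (S : Set X) (hS : IsClosed S) (U₁ : Opens X) (hU₁ : S ⊆ U₁) (p q : ℤ) :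
    letI U₀ : Opens X := ⟨Sᶜ, hS.isOpen_compl⟩
    ∃ (aJ : HArel F U₀ U₁ (p - 1) (q - 1) →ₗ[ℂ] HAcech F U₀ U₁ (p - 1) (q - 1))
      (aI : HAcech F U₀ U₁ (p - 1) (q - 1) →ₗ[ℂ] HAopen F U₀ (p - 1) (q - 1))
      (δBC : HAopen F U₀ (p - 1) (q - 1) →ₗ[ℂ] HBCrel F U₀ U₁ p q)
      (bJ : HBCrel F U₀ U₁ p q →ₗ[ℂ] HBCcech F U₀ U₁ p q)
      (bI : HBCcech F U₀ U₁ p q →ₗ[ℂ] HBCopen F U₀ p q)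
      (dJm : HDrel F U₀ U₁ p (q - 1) →ₗ[ℂ] HDcech F U₀ U₁ p (q - 1))
      (dIm : HDcech F U₀ U₁ p (q - 1) →ₗ[ℂ] HDopen F U₀ p (q - 1))
      (δD : HDopen F U₀ p (q - 1) →ₗ[ℂ] HDrel F U₀ U₁ p q)
      (dJ : HDrel F U₀ U₁ p q →ₗ[ℂ] HDcech F U₀ U₁ p q)
      (dI : HDcech F U₀ U₁ p q →ₗ[ℂ] HDopen F U₀ p q)
      (v1 : HArel F U₀ U₁ (p - 1) (q - 1) →ₗ[ℂ] HDrel F U₀ U₁ p (q - 1))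
      (v2 : HAcech F U₀ U₁ (p - 1) (q - 1) →ₗ[ℂ] HDcech F U₀ U₁ p (q - 1))
      (v3 : HAopen F U₀ (p - 1) (q - 1) →ₗ[ℂ] HDopen F U₀ p (q - 1))
      (v4 : HBCrel F U₀ U₁ p q →ₗ[ℂ] HDrel F U₀ U₁ p q)
      (v5 : HBCcech F U₀ U₁ p q →ₗ[ℂ] HDcech F U₀ U₁ p q)
      (v6 : HBCopen F U₀ p q →ₗ[ℂ] HDopen F U₀ p q),
      -- the maps of the first row
      ((∀ (ξ : RA F U₀ U₁ (p - 1) (q - 1)) (hξ : RtoTBC F U₀ U₁ (p - 1) (q - 1) ξ = 0),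
        ∃ h', aJ (cohomMk _ (RtoTBC F U₀ U₁ (p - 1) (q - 1)) ξ hξ)
          = cohomMk _ (DtoTBC F U₀ U₁ (p - 1) (q - 1))
              ((0 : ↥(F.E (p - 1) (q - 1) U₀)), ξ.1, ξ.2) h') ∧
      (∀ (ξ : TA F U₀ U₁ (p - 1) (q - 1)) (hξ : DtoTBC F U₀ U₁ (p - 1) (q - 1) ξ = 0),
        ∃ h', aI (cohomMk _ (DtoTBC F U₀ U₁ (p - 1) (q - 1)) ξ hξ)
          = cohomMk _ (ddbarW F U₀ (p - 1) (q - 1)) ξ.1 h') ∧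
      (∀ (θ : ↥(F.E (p - 1) (q - 1) U₀)) (hθ : ddbarW F U₀ (p - 1) (q - 1) θ = 0),
        ∃ h', δBC (cohomMk _ (ddbarW F U₀ (p - 1) (q - 1)) θ hθ)
          = cohomMk _ (RtoTT F U₀ U₁ p q)
              ((0 : ↥(F.E p q U₁)), -(F.res (p - 1) (q - 1) inf_le_left θ)) h') ∧
      (∀ (σ : RBC F U₀ U₁ p q) (hσ : RtoTT F U₀ U₁ p q σ = 0),
        ∃ h', bJ (cohomMk _ (RtoTT F U₀ U₁ p q) σ hσ)
          = cohomMk _ (DtoTT F U₀ U₁ p q) ((0 : ↥(F.E p q U₀)), σ.1, σ.2) h') ∧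
      (∀ (σ : TBC F U₀ U₁ p q) (hσ : DtoTT F U₀ U₁ p q σ = 0),
        ∃ h', bI (cohomMk _ (DtoTT F U₀ U₁ p q) σ hσ)
          = cohomMk _ (dfullW F U₀ p q) σ.1 h')) ∧
      -- the maps of the second row
      ((∀ (σ : RD F U₀ U₁ p (q - 1)) (hσ : DrD F U₀ U₁ p (q - 1) σ = 0),
        ∃ h', dJm (cohomMk _ (DrD F U₀ U₁ p (q - 1)) σ hσ)
          = cohomMk _ (DD F U₀ U₁ p (q - 1)) ((0 : ↥(F.E p (q - 1) U₀)), σ.1, σ.2) h') ∧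
      (∀ (σ : TD F U₀ U₁ p (q - 1)) (hσ : DD F U₀ U₁ p (q - 1) σ = 0),
        ∃ h', dIm (cohomMk _ (DD F U₀ U₁ p (q - 1)) σ hσ)
          = cohomMk _ (F.dbar p (q - 1) U₀) σ.1 h') ∧
      (∀ (θ : ↥(F.E p (q - 1) U₀)) (hθ : F.dbar p (q - 1) U₀ θ = 0),
        ∃ h', δD (cohomMk _ (F.dbar p (q - 1) U₀) θ hθ)
          = cohomMk _ (DrD F U₀ U₁ p q)
              ((0 : ↥(F.E p q U₁)), -(F.res p (q - 1) inf_le_left θ)) h') ∧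
      (∀ (σ : RD F U₀ U₁ p q) (hσ : DrD F U₀ U₁ p q σ = 0),
        ∃ h', dJ (cohomMk _ (DrD F U₀ U₁ p q) σ hσ)
          = cohomMk _ (DD F U₀ U₁ p q) ((0 : ↥(F.E p q U₀)), σ.1, σ.2) h') ∧
      (∀ (σ : TD F U₀ U₁ p q) (hσ : DD F U₀ U₁ p q σ = 0),
        ∃ h', dI (cohomMk _ (DD F U₀ U₁ p q) σ hσ)
          = cohomMk _ (F.dbar p q U₀) σ.1 h')) ∧
      -- the vertical maps, induced by `∂` on the Aeppli groups …
      ((∀ (ξ : RA F U₀ U₁ (p - 1) (q - 1)) (hξ : RtoTBC F U₀ U₁ (p - 1) (q - 1) ξ = 0),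
        ∃ h', v1 (cohomMk _ (RtoTBC F U₀ U₁ (p - 1) (q - 1)) ξ hξ)
          = cohomMk _ (DrD F U₀ U₁ p (q - 1))
              (F.cast U₁ (show p - 1 + 1 = p by ring) rfl
                  (F.del (p - 1) (q - 1) U₁ ξ.1),
                -(F.cast _ (show p - 1 + 1 = p by ring) rfl
                  (F.del (p - 1) (q - 1 - 1) (U₀ ⊓ U₁) ξ.2.1))) h') ∧
      (∀ (ξ : TA F U₀ U₁ (p - 1) (q - 1)) (hξ : DtoTBC F U₀ U₁ (p - 1) (q - 1) ξ = 0),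
        ∃ h', v2 (cohomMk _ (DtoTBC F U₀ U₁ (p - 1) (q - 1)) ξ hξ)
          = cohomMk _ (DD F U₀ U₁ p (q - 1))
              (F.cast U₀ (show p - 1 + 1 = p by ring) rfl
                  (F.del (p - 1) (q - 1) U₀ ξ.1),
                F.cast U₁ (show p - 1 + 1 = p by ring) rfl
                  (F.del (p - 1) (q - 1) U₁ ξ.2.1),
                -(F.cast _ (show p - 1 + 1 = p by ring) rfl
                  (F.del (p - 1) (q - 1 - 1) (U₀ ⊓ U₁) ξ.2.2.1))) h') ∧
      (∀ (θ : ↥(F.E (p - 1) (q - 1) U₀)) (hθ : ddbarW F U₀ (p - 1) (q - 1) θ = 0),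
        ∃ h', v3 (cohomMk _ (ddbarW F U₀ (p - 1) (q - 1)) θ hθ)
          = cohomMk _ (F.dbar p (q - 1) U₀)
              (F.cast U₀ (show p - 1 + 1 = p by ring) rfl
                (F.del (p - 1) (q - 1) U₀ θ)) h') ∧
      -- … and by `σ₀₁ ↦ ∂σ₀₁` on the Bott–Chern groups
      (∀ (σ : RBC F U₀ U₁ p q) (hσ : RtoTT F U₀ U₁ p q σ = 0),
        ∃ h', v4 (cohomMk _ (RtoTT F U₀ U₁ p q) σ hσ)
          = cohomMk _ (DrD F U₀ U₁ p q)
              (σ.1, F.cast _ (show p - 1 + 1 = p by ring) rfl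
                (F.del (p - 1) (q - 1) (U₀ ⊓ U₁) σ.2)) h') ∧
      (∀ (σ : TBC F U₀ U₁ p q) (hσ : DtoTT F U₀ U₁ p q σ = 0),
        ∃ h', v5 (cohomMk _ (DtoTT F U₀ U₁ p q) σ hσ)
          = cohomMk _ (DD F U₀ U₁ p q)
              (σ.1, σ.2.1, F.cast _ (show p - 1 + 1 = p by ring) rfl
                (F.del (p - 1) (q - 1) (U₀ ⊓ U₁) σ.2.2)) h') ∧
      (∀ (θ : ↥(F.E p q U₀)) (hθ : dfullW F U₀ p q θ = 0),
        ∃ h', v6 (cohomMk _ (dfullW F U₀ p q) θ hθ)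
          = cohomMk _ (F.dbar p q U₀) θ h')) ∧
      -- exactness of the rows
      (Function.Exact ⇑aJ ⇑aI ∧ Function.Exact ⇑aI ⇑δBC ∧
        Function.Exact ⇑δBC ⇑bJ ∧ Function.Exact ⇑bJ ⇑bI) ∧
      (Function.Exact ⇑dJm ⇑dIm ∧ Function.Exact ⇑dIm ⇑δD ∧
        Function.Exact ⇑δD ⇑dJ ∧ Function.Exact ⇑dJ ⇑dI) ∧
      -- commutativity of the five squares
      ((∀ x, v2 (aJ x) = dJm (v1 x)) ∧ (∀ x, v3 (aI x) = dIm (v2 x)) ∧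
        (∀ x, v4 (δBC x) = δD (v3 x)) ∧ (∀ x, v5 (bJ x) = dJ (v4 x)) ∧
        (∀ x, v6 (bI x) = dI (v5 x))) := by
  generalize (⟨Sᶜ, hS.isOpen_compl⟩ : Opens X) = U₀
  refine ⟨aeppliRelToCech F U₀ U₁ (p - 1) (q - 1), aeppliCechToOpen F U₀ U₁ (p - 1) (q - 1),
    aeppliConnecting F U₀ U₁ p q, bottChernRelToCech F U₀ U₁ p q, bottChernCechToOpen F U₀ U₁ p q,
    dolbeaultRelToCech F U₀ U₁ p (q - 1), dolbeaultCechToOpen F U₀ U₁ p (q - 1),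
    dolbeaultConnecting F U₀ U₁ p q, dolbeaultRelToCech F U₀ U₁ p q,
    dolbeaultCechToOpen F U₀ U₁ p q, delRel F U₀ U₁ p q, delCech F U₀ U₁ p q, delOpen F U₀ p q,
    bottChernToDolbeaultRel F U₀ U₁ p q, bottChernToDolbeaultCech F U₀ U₁ p q,
    bottChernToDolbeaultOpen F U₀ p q, ⟨?_, ?_, ?_, ?_, ?_⟩, ⟨?_, ?_, ?_, ?_, ?_⟩,
    ⟨?_, ?_, ?_, ?_, ?_, ?_⟩,
    ⟨exact_aeppliRelToCech_aeppliCechToOpen F U₀ U₁ (p - 1) (q - 1),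
      exact_aeppliCechToOpen_aeppliConnecting F U₀ U₁ p q,
      exact_aeppliConnecting_bottChernRelToCech F U₀ U₁ p q,
      exact_bottChernRelToCech_bottChernCechToOpen F U₀ U₁ p q⟩,
    ⟨exact_dolbeaultRelToCech_dolbeaultCechToOpen F U₀ U₁ p (q - 1),
      exact_dolbeaultCechToOpen_dolbeaultConnecting F U₀ U₁ p q,
      exact_dolbeaultConnecting_dolbeaultRelToCech F U₀ U₁ p q,
      exact_dolbeaultRelToCech_dolbeaultCechToOpen F U₀ U₁ p q⟩,
    delCech_aeppliRelToCech F U₀ U₁ p q, delOpen_aeppliCechToOpen F U₀ U₁ p q,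
    bottChernToDolbeaultRel_aeppliConnecting F U₀ U₁ p q,
    bottChernToDolbeaultCech_bottChernRelToCech F U₀ U₁ p q,
    bottChernToDolbeaultOpen_bottChernCechToOpen F U₀ U₁ p q⟩
  all_goals
    intro x hx
    exact ⟨_, cohomMap_mk _ _ _ _ _ _ _ x hx⟩
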